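/- arXiv:2306.08239 — 2 statements merged into one kernel-verified Lean document; each statement's English description precedes it below -/
import Mathlib

section
/- Let F be a filter on the set 2^{<ω} of finite binary strings (a proper filter, i.e., not containing the empty set) such that every member of F is somewhere dense, and let Y ⊆ 2^{<ω} be arbitrary. Then either the filter generated by F ∪ {Y} is proper and every member of it is somewhere dense, or the filter generated by F ∪ {2^{<ω} \ Y} is proper and every member of it is somewhere dense. -/
/-- `X` is dense above `σ` in the full binary tree `2^{<ω}`: every `τ ⊵ σ`
has an extension `η ⊵ τ` lying in `X`. -/
def DenseAbove (X : Set (List Bool)) (σ : List Bool) : Prop :=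
  ∀ τ : List Bool, σ <+: τ → ∃ η ∈ X, τ <+: η

/-- `X ⊆ 2^{<ω}` is somewhere dense if it is dense above some node `σ`. -/
def SomewhereDense (X : Set (List Bool)) : Prop :=
  ∃ σ : List Bool, DenseAbove X σ

theorem SomewhereDense.mono {X Z : Set (List Bool)} (h : X ⊆ Z) :
    SomewhereDense X → SomewhereDense Z := by
  rintro ⟨σ, hσ⟩
  refine ⟨σ, fun τ hτ => ?_⟩
  obtain ⟨η, hη, hτη⟩ := hσ τ hτ
  exact ⟨η, h hη, hτη⟩

theorem not_somewhereDense_empty : ¬ SomewhereDense ∅ := by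
  rintro ⟨σ, hσ⟩
  obtain ⟨η, hη, -⟩ := hσ σ List.prefix_rfl
  exact hη

theorem SomewhereDense.or_of_union {A B : Set (List Bool)} (h : SomewhereDense (A ∪ B)) :
    SomewhereDense A ∨ SomewhereDense B := by
  obtain ⟨σ, hσ⟩ := h
  by_cases hA : DenseAbove A σ
  · exact Or.inl ⟨σ, hA⟩
  · unfold DenseAbove at hA
    push Not at hA
    obtain ⟨τ, hστ, hτ⟩ := hA
    refine Or.inr ⟨τ, fun ρ hρ => ?_⟩
    obtain ⟨η, hη | hη, hρη⟩ := hσ ρ (hστ.trans hρ)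
    · exact absurd (hρ.trans hρη) (hτ η hη)
    · exact ⟨η, hη, hρη⟩

theorem neBot_of_forall_somewhereDense {G : Filter (List Bool)}
    (hG : ∀ X ∈ G, SomewhereDense X) : G.NeBot :=
  Filter.neBot_iff.2 fun h =>
    not_somewhereDense_empty (hG ∅ (Filter.empty_mem_iff_bot.2 h))

/-- If `F` is a proper filter on `2^{<ω}` all of whose members are somewhere dense,
then for any `Y ⊆ 2^{<ω}`, either the filter generated by `F ∪ {Y}` (namely
`F ⊓ 𝓟 Y`) is proper and all of its members are somewhere dense, or the filter
generated by `F ∪ {2^{<ω} \ Y}` (namely `F ⊓ 𝓟 Yᶜ`) is proper and all of its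
members are somewhere dense. -/
theorem extend_everywhereSomewhereDense_filter (F : Filter (List Bool)) (hproper : F.NeBot)
    (hF : ∀ X ∈ F, SomewhereDense X) (Y : Set (List Bool)) :
    ((F ⊓ Filter.principal Y).NeBot ∧
        ∀ X ∈ F ⊓ Filter.principal Y, SomewhereDense X) ∨
    ((F ⊓ Filter.principal Yᶜ).NeBot ∧
        ∀ X ∈ F ⊓ Filter.principal Yᶜ, SomewhereDense X) := by
  by_contra! hcon
  obtain ⟨hY, hYc⟩ := hcon
  have hY' : ¬ ∀ X ∈ F ⊓ Filter.principal Y, SomewhereDense X := fun h => by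
    obtain ⟨X, hX, hXd⟩ := hY (neBot_of_forall_somewhereDense h)
    exact hXd (h X hX)
  have hYc' : ¬ ∀ X ∈ F ⊓ Filter.principal Yᶜ, SomewhereDense X := fun h => by
    obtain ⟨X, hX, hXd⟩ := hYc (neBot_of_forall_somewhereDense h)
    exact hXd (h X hX)
  push Not at hY' hYc'
  obtain ⟨A, hA, hAd⟩ := hY'
  obtain ⟨B, hB, hBd⟩ := hYc'
  rw [Filter.mem_inf_principal] at hA hB
  have hAB : SomewhereDense (A ∪ B) := by
    refine (hF _ (Filter.inter_mem hA hB)).mono fun x hx => ?_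
    by_cases hxY : x ∈ Y
    · exact Or.inl (hx.1 hxY)
    · exact Or.inr (hx.2 hxY)
  exact hAB.or_of_union.elim hAd hBd
end

section
/- Let (σ_n)_{n<ω} be a sequence in 2^{<ω} such that σ_{n+1} ⊵ σ_n⌢1 for every n < ω. Then for any k < ω, any strictly increasing sequence of natural numbers n_0 < n_1 < ⋯ < n_{k-1}, and any elements τ_0, …, τ_{k-1} ∈ 2^{<ω} with τ_i ⊵ σ_{n_i}⌢0 for each i < k, the set {τ_0, …, τ_{k-1}} is a right-comb of cardinality k. -/
/-- The class of right-combs in the full binary tree `2^{<ω}` (nodes are finite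
binary strings, `σ <+: τ` means `σ` is a prefix of `τ`, i.e. `τ ⊵ σ`; `false`
plays the role of the bit `0` and `true` of the bit `1`). -/
inductive RightComb : Set (List Bool) → Prop
  | of_subsingleton {X : Set (List Bool)} (h : X.Subsingleton) : RightComb X
  | step {X : Set (List Bool)} (σ : List Bool)
      (hsub : ∀ τ ∈ X, σ <+: τ ∧ τ ≠ σ)
      (hone : (X ∩ {τ : List Bool | σ ++ [false] <+: τ}).ncard = 1)
      (hcomb : RightComb (X ∩ {τ : List Bool | σ ++ [true] <+: τ})) : RightComb X

theorem append_true_isPrefix_of_lt {σ : ℕ → List Bool}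
    (hσ : ∀ n : ℕ, σ n ++ [true] <+: σ (n + 1)) {a b : ℕ} (h : a < b) :
    σ a ++ [true] <+: σ b := by
  induction b, h using Nat.le_induction with
  | base => exact hσ a
  | succ b _ ih => exact ih.trans ((List.prefix_append _ _).trans (hσ b))

theorem not_append_true_isPrefix_of_append_false {ρ τ : List Bool}
    (h : ρ ++ [false] <+: τ) : ¬ ρ ++ [true] <+: τ := by
  rintro ⟨s, rfl⟩
  rw [List.append_assoc, List.prefix_append_right_inj] at h
  simp at h

theorem append_true_isPrefix_offshoot {σ : ℕ → List Bool}
    (hσ : ∀ n : ℕ, σ n ++ [true] <+: σ (n + 1)) {a b : ℕ} (h : a < b) {τ : List Bool}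
    (hτ : σ b ++ [false] <+: τ) : σ a ++ [true] <+: τ :=
  (append_true_isPrefix_of_lt hσ h).trans ((List.prefix_append _ _).trans hτ)

theorem offshoots_injective {σ : ℕ → List Bool}
    (hσ : ∀ n : ℕ, σ n ++ [true] <+: σ (n + 1))
    {k : ℕ} {n : Fin k → ℕ} (hn : StrictMono n)
    {τ : Fin k → List Bool} (hτ : ∀ i : Fin k, σ (n i) ++ [false] <+: τ i) :
    Function.Injective τ := by
  refine Function.Injective.of_lt_imp_ne fun i j hij h => ?_
  exact not_append_true_isPrefix_of_append_false (hτ i)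
    (h ▸ append_true_isPrefix_offshoot hσ (hn hij) (hτ j))

theorem rightComb_range_offshoots {σ : ℕ → List Bool}
    (hσ : ∀ n : ℕ, σ n ++ [true] <+: σ (n + 1))
    {k : ℕ} {n : Fin k → ℕ} (hn : StrictMono n)
    {τ : Fin k → List Bool} (hτ : ∀ i : Fin k, σ (n i) ++ [false] <+: τ i) :
    RightComb (Set.range τ) := by
  induction k with
  | zero => exact .of_subsingleton (by simp [Set.range_eq_empty])
  | succ k ih =>
    have htrue : ∀ i : Fin k, σ (n 0) ++ [true] <+: τ i.succ := fun i =>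
      append_true_isPrefix_offshoot hσ (hn i.succ_pos) (hτ i.succ)
    have hfalse_inter :
        Set.range τ ∩ {ρ | σ (n 0) ++ [false] <+: ρ} = {τ 0} := by
      ext ρ
      simp only [Set.mem_inter_iff, Set.mem_range, Set.mem_ofPred_eq, Set.mem_singleton_iff]
      constructor
      · rintro ⟨⟨i, rfl⟩, h⟩
        cases i using Fin.cases with
        | zero => rfl
        | succ i => exact absurd (htrue i) (not_append_true_isPrefix_of_append_false h)
      · rintro rfl
        exact ⟨⟨0, rfl⟩, hτ 0⟩
    have htrue_inter :
        Set.range τ ∩ {ρ | σ (n 0) ++ [true] <+: ρ} = Set.range (fun i : Fin k => τ i.succ) := by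
      ext ρ
      simp only [Set.mem_inter_iff, Set.mem_range, Set.mem_ofPred_eq]
      constructor
      · rintro ⟨⟨i, rfl⟩, h⟩
        cases i using Fin.cases with
        | zero => exact absurd h (not_append_true_isPrefix_of_append_false (hτ 0))
        | succ i => exact ⟨i, rfl⟩
      · rintro ⟨i, rfl⟩
        exact ⟨⟨i.succ, rfl⟩, htrue i⟩
    refine .step (σ (n 0)) ?_ (by rw [hfalse_inter, Set.ncard_singleton]) ?_
    · have strict_of_append : ∀ {b : Bool} {ρ : List Bool}, σ (n 0) ++ [b] <+: ρ →
          σ (n 0) <+: ρ ∧ ρ ≠ σ (n 0) := fun h =>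
        ⟨(List.prefix_append _ _).trans h, by rintro rfl; simpa using h.length_le⟩
      rintro _ ⟨i, rfl⟩
      cases i using Fin.cases with
      | zero => exact strict_of_append (hτ 0)
      | succ i => exact strict_of_append (htrue i)
    · rw [htrue_inter]
      exact ih (hn.comp (Fin.strictMono_succ)) fun i => hτ i.succ

/-- If `(σ_n)` is a sequence with `σ_{n+1} ⊵ σ_n⌢1` for all `n`, then for any
strictly increasing `n_0 < ⋯ < n_{k-1}` and any `τ_i ⊵ σ_{n_i}⌢0`, the set
`{τ_0, …, τ_{k-1}}` is a right-comb of cardinality `k`. -/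
theorem rightComb_of_offshoots (σ : ℕ → List Bool)
    (hσ : ∀ n : ℕ, σ n ++ [true] <+: σ (n + 1))
    (k : ℕ) (n : Fin k → ℕ) (hn : StrictMono n)
    (τ : Fin k → List Bool) (hτ : ∀ i : Fin k, σ (n i) ++ [false] <+: τ i) :
    RightComb (Set.range τ) ∧ (Set.range τ).ncard = k := by
  refine ⟨rightComb_range_offshoots hσ hn hτ, ?_⟩
  rw [← Set.image_univ, Set.ncard_image_of_injective _ (offshoots_injective hσ hn hτ),
    Set.ncard_univ, Nat.card_fin]
end
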